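/- arXiv:2106.06352 — 3 statements merged into one kernel-verified Lean document; each statement's English description precedes it below -/
import Mathlib

section
/- In the Laplacian model, the collection of entries of M_n consisting of the diagonal entries M_{i,i} for i ∈ [n] together with the entries M_{i,j} for i ∈ [n] and n+1 ≤ j ≤ (1+α)n − p has min-entropy min(q, 1−q)^p. -/
open MeasureTheory

instance zmodMeasurableSpace (n : ℕ) : MeasurableSpace (ZMod n) := ⊤

/-- The Bernoulli-type measure on `ZMod p`: value `1` with probability `q`,
value `0` with probability `1 - q`. -/
noncomputable def bern (p : ℕ) (q : ℝ) : Measure (ZMod p) :=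
  ENNReal.ofReal q • Measure.dirac 1 + ENNReal.ofReal (1 - q) • Measure.dirac 0

instance bern_isFiniteMeasure (p : ℕ) (q : ℝ) : IsFiniteMeasure (bern p q) := by
  constructor
  simp [bern]

/-- Index type for the independent edge indicators of the random directed bipartite graph. -/
abbrev LapIdx (n a : ℕ) := Fin n × Fin a ⊕ Fin a × Fin n

/-- The product (Bernoulli) measure on the space of edge indicators. -/
noncomputable def lapMeasure (p n a : ℕ) (q : ℝ) : Measure (LapIdx n a → ZMod p) :=
  Measure.pi fun _ => bern p q

/-- The Laplacian of the random directed bipartite graph on parts of sizes `n` and `a`,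
as a function of the edge indicators `ω`. -/
def lapM (p n a : ℕ) (ω : LapIdx n a → ZMod p) :
    Matrix (Fin (n + a)) (Fin (n + a)) (ZMod p) := fun i j =>
  if hi : (i : ℕ) < n then
    if hj : (j : ℕ) < n then
      (if (i : ℕ) = (j : ℕ) then -∑ k : Fin a, ω (Sum.inl (⟨i, hi⟩, k)) else 0)
    else ω (Sum.inl (⟨i, hi⟩, ⟨(j : ℕ) - n, by have := j.isLt; omega⟩))
  else
    if hj : (j : ℕ) < n then
      ω (Sum.inr (⟨(i : ℕ) - n, by have := i.isLt; omega⟩, ⟨j, hj⟩))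
    else
      (if (i : ℕ) = (j : ℕ) then
        -∑ k : Fin n, ω (Sum.inr (⟨(i : ℕ) - n, by have := i.isLt; omega⟩, k)) else 0)

/-- The submatrix consisting of the first `m` rows of the Laplacian. -/
def firstRows (p n a m : ℕ) (h : m ≤ n + a) (ω : LapIdx n a → ZMod p) :
    Matrix (Fin m) (Fin (n + a)) (ZMod p) :=
  fun i j => lapM p n a ω (Fin.castLE h i) j

/-- A family of `ZMod p`-valued random variables `X j`, for `j` ranging over the set `S`,
has min-entropy `β` if, conditioned on any assignment of values (of positive probability)
to the variables in `S` other than `X i`, the probability that `X i` takes any given value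
is at most `1 - β`. -/
def HasMinEntropySet {Ω ι : Type*} [MeasurableSpace Ω] (μ : MeasureTheory.Measure Ω)
    {p : ℕ} (S : Set ι) (X : ι → Ω → ZMod p) (β : ℝ) : Prop :=
  ∀ i ∈ S, ∀ v : ZMod p, ∀ y : ι → ZMod p,
    μ {ω | ∀ j ∈ S, j ≠ i → X j ω = y j} ≠ 0 →
    μ {ω | X i ω = v ∧ ∀ j ∈ S, j ≠ i → X j ω = y j} ≤
      ENNReal.ofReal (1 - β) * μ {ω | ∀ j ∈ S, j ≠ i → X j ω = y j}

open Finset in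
/-- A product of Bernoulli measures is the sum over all supports of weighted Dirac masses. -/
theorem pi_bern_eq_sum_dirac {E : Type*} [Fintype E] [DecidableEq E] {p : ℕ} {q : ℝ}
    (hq0 : 0 ≤ q) (hq1 : q ≤ 1) :
    Measure.pi (fun _ : E => bern p q) =
      ∑ S : Finset E, ENNReal.ofReal (q ^ #S * (1 - q) ^ (Fintype.card E - #S)) •
        Measure.dirac (fun e => if e ∈ S then (1 : ZMod p) else 0) := by
  refine Measure.pi_eq fun s hs => ?_
  have hr : 0 ≤ 1 - q := by linarith
  simp only [bern, Measure.add_apply, Measure.smul_apply, smul_eq_mul, Measure.finsetSum_apply,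
    prod_add, powerset_univ]
  refine sum_congr rfl fun S _ => ?_
  rw [prod_mul_distrib, prod_mul_distrib, prod_const, prod_const,
    card_sdiff_of_subset (subset_univ S), card_univ, ENNReal.ofReal_mul (by positivity),
    ENNReal.ofReal_pow hq0, ENNReal.ofReal_pow hr,
    Measure.dirac_apply' _ (MeasurableSet.univ_pi hs), mul_mul_mul_comm]
  congr 1
  have h1 : ∀ i ∈ S, Measure.dirac (1 : ZMod p) (s i) =
      (s i).indicator 1 (if i ∈ S then (1 : ZMod p) else 0) := fun i hi => by
    rw [if_pos hi, Measure.dirac_apply' _ (hs i)]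
  have h0 : ∀ i ∈ univ \ S, Measure.dirac (0 : ZMod p) (s i) =
      (s i).indicator 1 (if i ∈ S then (1 : ZMod p) else 0) := fun i hi => by
    rw [if_neg (mem_sdiff.1 hi).2, Measure.dirac_apply' _ (hs i)]
  rw [prod_congr rfl h1, prod_congr rfl h0, mul_comm, prod_sdiff (subset_univ S)]
  by_cases h : (fun e => if e ∈ S then (1 : ZMod p) else 0) ∈ Set.univ.pi s
  · rw [Set.indicator_of_mem h, prod_eq_one]
    · rfl
    · intro i _
      rw [Set.indicator_of_mem (h i trivial)]
      rfl
  · rw [Set.indicator_of_notMem h]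
    simp only [Set.mem_pi, Set.mem_univ, true_implies, not_forall] at h
    obtain ⟨i, hi⟩ := h
    exact (prod_eq_zero (mem_univ i) (Set.indicator_of_notMem hi _)).symm

open Finset in
theorem pi_bern_apply {E : Type*} [Fintype E] [DecidableEq E] {p : ℕ} [NeZero p] {q : ℝ}
    (hq0 : 0 ≤ q) (hq1 : q ≤ 1) (A : Set (E → ZMod p)) [DecidablePred (· ∈ A)] :
    Measure.pi (fun _ : E => bern p q) A =
      ENNReal.ofReal (∑ S : Finset E,
        if (fun e => if e ∈ S then (1 : ZMod p) else 0) ∈ A then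
          q ^ #S * (1 - q) ^ (Fintype.card E - #S) else 0) := by
  have hr : 0 ≤ 1 - q := by linarith
  rw [pi_bern_eq_sum_dirac hq0 hq1, Measure.finsetSum_apply,
    ENNReal.ofReal_sum_of_nonneg fun S _ => by split_ifs <;> positivity]
  refine sum_congr rfl fun S _ => ?_
  rw [Measure.smul_apply, Measure.dirac_apply' _ MeasurableSet.of_discrete, smul_eq_mul]
  split_ifs with h
  · simp [Set.indicator_of_mem h]
  · simp [Set.indicator_of_notMem h]

theorem min_pow_le {p k : ℕ} {q : ℝ} (hq0 : 0 ≤ q) (hq1 : q ≤ 1) (hk : k ≤ p) :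
    min q (1 - q) ^ p ≤ q ^ k * (1 - q) ^ (p - k) := by
  have hr : 0 ≤ 1 - q := by linarith
  have hm : 0 ≤ min q (1 - q) := le_min hq0 hr
  calc min q (1 - q) ^ p = min q (1 - q) ^ k * min q (1 - q) ^ (p - k) := by
        rw [← pow_add, Nat.add_sub_cancel' hk]
    _ ≤ _ := by
        gcongr
        · exact min_le_left _ _
        · exact min_le_right _ _

theorem min_pow_mul_succ_le_one {p : ℕ} {q : ℝ} (hq0 : 0 ≤ q) (hq1 : q ≤ 1) :
    min q (1 - q) ^ p * (p + 1) ≤ 1 := by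
  have hm0 : 0 ≤ min q (1 - q) := le_min hq0 (by linarith)
  have hm : min q (1 - q) ≤ 1 / 2 := by
    rcases le_total q (1 / 2) with h | h
    · exact (min_le_left _ _).trans h
    · exact (min_le_right _ _).trans (by linarith)
  have hp : (p + 1 : ℝ) ≤ 2 ^ p := by exact_mod_cast Nat.succ_le_of_lt Nat.lt_two_pow_self
  calc min q (1 - q) ^ p * (p + 1) ≤ (1 / 2) ^ p * 2 ^ p := by gcongr
    _ = 1 := by rw [← mul_pow]; norm_num

theorem choose_succ_le_mul_choose (p k : ℕ) : p.choose (k + 1) ≤ p * p.choose k :=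
  calc p.choose (k + 1) ≤ p.choose (k + 1) * (k + 1) := Nat.le_mul_of_pos_right _ k.succ_pos
    _ = p.choose k * (p - k) := Nat.choose_succ_right_eq p k
    _ ≤ p.choose k * p := Nat.mul_le_mul_left _ (Nat.sub_le _ _)
    _ = _ := mul_comm _ _

theorem choose_le_mul_choose_succ {p k : ℕ} (hk : k < p) :
    p.choose k ≤ p * p.choose (k + 1) :=
  calc p.choose k ≤ p.choose k * (p - k) := Nat.le_mul_of_pos_right _ (by omega)
    _ = p.choose (k + 1) * (k + 1) := (Nat.choose_succ_right_eq p k).symm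
    _ ≤ p.choose (k + 1) * p := Nat.mul_le_mul_left _ hk
    _ = _ := mul_comm _ _

open Finset in
theorem mul_sum_choose_le_mul_sum_choose_shift {p : ℕ} (hp : 2 ≤ p) {c R : ℝ} (f : ℕ → ℝ)
    (hf : ∀ k, 0 ≤ f k) (hc0 : 0 ≤ c) (hc : c * (p + 1) ≤ 1) (hR : R ≤ 1)
    (h : c * f 0 ≤ R * f p) :
    c * ∑ k ∈ range (p + 1), p.choose k • f k ≤
      (1 - c) * ∑ k ∈ range (p + 1), p.choose k • f (k + 1) := by
  obtain ⟨t, rfl⟩ : ∃ t, p = t + 1 := ⟨p - 1, by omega⟩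
  have hp' : (2 : ℝ) ≤ ((t + 1 : ℕ) : ℝ) := by exact_mod_cast hp
  have hmid : c * ∑ k ∈ range t, ((t + 1).choose (k + 1) : ℝ) * f (k + 1) ≤
      (1 - c) * ∑ k ∈ range t, ((t + 1).choose k : ℝ) * f (k + 1) := by
    rw [mul_sum, mul_sum]
    refine sum_le_sum fun k _ => ?_
    rw [← mul_assoc, ← mul_assoc]
    refine mul_le_mul_of_nonneg_right ?_ (hf _)
    have h1 : ((t + 1).choose (k + 1) : ℝ) ≤ ((t + 1 : ℕ) : ℝ) * (t + 1).choose k := by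
      exact_mod_cast choose_succ_le_mul_choose (t + 1) k
    calc c * ((t + 1).choose (k + 1) : ℝ)
        ≤ c * (((t + 1 : ℕ) : ℝ) * (t + 1).choose k) := by gcongr
      _ = c * ((t + 1 : ℕ) : ℝ) * (t + 1).choose k := by ring
      _ ≤ (1 - c) * (t + 1).choose k := by gcongr; linarith
  have hc3 : c ≤ 1 / 3 := by nlinarith
  have hend : (R + c) * f (t + 1) ≤ (1 - c) * ((t + 1 : ℕ) : ℝ) * f (t + 1) :=
    mul_le_mul_of_nonneg_right (by nlinarith) (hf _)
  have hlast : 0 ≤ (1 - c) * f (t + 1 + 1) := mul_nonneg (by linarith) (hf _)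
  simp only [nsmul_eq_mul]
  rw [sum_range_succ', sum_range_succ _ t, sum_range_succ _ (t + 1), sum_range_succ _ t]
  simp only [Nat.choose_self, Nat.choose_zero_right, Nat.choose_succ_self_right, Nat.cast_one,
    one_mul]
  linarith

open Finset in
theorem mul_sum_choose_shift_le_mul_sum_choose {p : ℕ} (hp : 2 ≤ p) {c R : ℝ} (f : ℕ → ℝ)
    (hf : ∀ k, 0 ≤ f k) (hc0 : 0 ≤ c) (hc : c * (p + 1) ≤ 1) (hR : R ≤ 1)
    (h : c * f (p + 1) ≤ R * f 1) :
    c * ∑ k ∈ range (p + 1), p.choose k • f (k + 1) ≤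
      (1 - c) * ∑ k ∈ range (p + 1), p.choose k • f k := by
  have hrefl := mul_sum_choose_le_mul_sum_choose_shift hp (fun k => f (p + 1 - k))
    (fun k => hf _) hc0 hc hR (by simpa using h)
  have e1 : ∑ k ∈ range (p + 1), p.choose k • f (k + 1) =
      ∑ k ∈ range (p + 1), p.choose k • f (p + 1 - k) := by
    rw [← sum_range_reflect]
    refine sum_congr rfl fun k hk => ?_
    have hk' : k ≤ p := Nat.lt_succ_iff.1 (mem_range.1 hk)
    rw [show p + 1 - 1 - k = p - k by omega, Nat.choose_symm hk',
      show p - k + 1 = p + 1 - k by omega]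
  have e2 : ∑ k ∈ range (p + 1), p.choose k • f k =
      ∑ k ∈ range (p + 1), p.choose k • f (p + 1 - (k + 1)) := by
    rw [← sum_range_reflect]
    refine sum_congr rfl fun k hk => ?_
    have hk' : k ≤ p := Nat.lt_succ_iff.1 (mem_range.1 hk)
    rw [show p + 1 - 1 - k = p - k by omega, Nat.choose_symm hk',
      show p + 1 - (k + 1) = p - k by omega]
  rw [e1, e2]
  exact hrefl

open Finset in
/-- The sum of `p` independent Bernoulli variables modulo `p` takes no value with probability
exceeding `1 - min q (1 - q) ^ p`. -/
theorem pi_bern_sum_eq_le {E : Type*} [Fintype E] {p : ℕ} (hp : p.Prime) {q : ℝ}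
    (hq0 : 0 ≤ q) (hq1 : q ≤ 1) (hE : Fintype.card E = p) (s : ZMod p) :
    Measure.pi (fun _ : E => bern p q) {x | ∑ e, x e = s} ≤
      ENNReal.ofReal (1 - min q (1 - q) ^ p) *
        Measure.pi (fun _ : E => bern p q) Set.univ := by
  classical
  have : Fact p.Prime := ⟨hp⟩
  have hr : 0 ≤ 1 - q := by linarith
  have hcard : ∀ S : Finset E, #S ≤ p := fun S => hE ▸ card_le_univ S
  obtain ⟨T, hT⟩ : ∃ T : Finset E, (#T : ZMod p) ≠ s := by
    by_cases h : s = 0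
    · obtain ⟨e⟩ : Nonempty E := Fintype.card_pos_iff.1 (hE ▸ hp.pos)
      exact ⟨{e}, by simp [h]⟩
    · exact ⟨∅, by simpa using Ne.symm h⟩
  have htotal : ∑ S : Finset E, q ^ #S * (1 - q) ^ (p - #S) = 1 := by
    rw [← hE, Fintype.sum_pow_mul_eq_add_pow]
    simp
  rw [pi_bern_apply hq0 hq1, pi_bern_apply hq0 hq1]
  simp only [Set.mem_ofPred_eq, Set.mem_univ, if_true, hE, htotal, ENNReal.ofReal_one, mul_one]
  refine ENNReal.ofReal_le_ofReal ?_
  simp only [sum_boole, filter_univ_mem]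
  suffices h : ∑ S : Finset E, (if (#S : ZMod p) = s then q ^ #S * (1 - q) ^ (p - #S) else 0) +
      min q (1 - q) ^ p ≤ ∑ S : Finset E, q ^ #S * (1 - q) ^ (p - #S) by
    linarith
  rw [← add_sum_erase _ _ (mem_univ T),
    ← add_sum_erase univ (fun S : Finset E => q ^ #S * (1 - q) ^ (p - #S)) (mem_univ T),
    if_neg hT, zero_add, add_comm]
  refine add_le_add (min_pow_le hq0 hq1 (hcard T)) (sum_le_sum fun S _ => ?_)
  split_ifs
  · exact le_rfl
  · positivity

open Finset in
/-- Given the sum modulo `p` of `p + 1` independent Bernoulli variables, one of them takes no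
value with conditional probability exceeding `1 - min q (1 - q) ^ p`. -/
theorem pi_bern_coord_and_sum_eq_le {E : Type*} [Fintype E] {p : ℕ} (hp : p.Prime) {q : ℝ}
    (hq0 : 0 ≤ q) (hq1 : q ≤ 1) (hE : Fintype.card E = p + 1) (e₀ : E) (v s : ZMod p) :
    Measure.pi (fun _ : E => bern p q) {x | x e₀ = v ∧ ∑ e, x e = s} ≤
      ENNReal.ofReal (1 - min q (1 - q) ^ p) *
        Measure.pi (fun _ : E => bern p q) {x | ∑ e, x e = s} := by
  classical
  have : Fact p.Prime := ⟨hp⟩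
  have hr : 0 ≤ 1 - q := by linarith
  have hm0 : 0 ≤ min q (1 - q) := le_min hq0 hr
  have hcp := min_pow_mul_succ_le_one (p := p) hq0 hq1
  have hc0 : 0 ≤ min q (1 - q) ^ p := pow_nonneg hm0 p
  have hc1 : 0 ≤ 1 - min q (1 - q) ^ p := by nlinarith [(Nat.cast_nonneg p : (0 : ℝ) ≤ p)]
  have hp2 := hp.two_le
  let f : ℕ → ℝ := fun k => if (k : ZMod p) = s then q ^ k * (1 - q) ^ (p + 1 - k) else 0
  have hf : ∀ k, 0 ≤ f k := fun k => by dsimp only [f]; split_ifs <;> positivity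
  have hf0 : min q (1 - q) ^ p * f 0 ≤ (1 - q) ^ p * f p := by
    simp only [f, Nat.cast_zero, CharP.cast_eq_zero]
    split_ifs
    · rw [show p + 1 - p = 1 by omega, Nat.sub_zero, pow_succ (1 - q) p]
      have : min q (1 - q) ^ p ≤ q ^ p := by gcongr; exact min_le_left _ _
      calc _ ≤ q ^ p * (q ^ 0 * ((1 - q) ^ p * (1 - q))) := by gcongr
        _ = _ := by ring
    · simp
  have hf1 : min q (1 - q) ^ p * f (p + 1) ≤ q ^ p * f 1 := by
    simp only [f, Nat.cast_one, Nat.cast_add, CharP.cast_eq_zero, zero_add]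
    split_ifs
    · rw [Nat.sub_self, Nat.add_sub_cancel]
      have : min q (1 - q) ^ p ≤ (1 - q) ^ p := by gcongr; exact min_le_right _ _
      calc _ ≤ (1 - q) ^ p * (q ^ (p + 1) * (1 - q) ^ 0) := by gcongr
        _ = _ := by ring
    · simp
  have hshift := mul_sum_choose_le_mul_sum_choose_shift hp2 f hf hc0 hcp
    (pow_le_one₀ hr (by linarith)) hf0
  have hunshift := mul_sum_choose_shift_le_mul_sum_choose hp2 f hf hc0 hcp
    (pow_le_one₀ hq0 hq1) hf1
  have hnot : e₀ ∉ univ.erase e₀ := notMem_erase _ _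
  have hsplit : ∀ F : Finset E → ℝ, ∑ S, F S =
      ∑ S ∈ (univ.erase e₀).powerset, F S +
        ∑ S ∈ (univ.erase e₀).powerset, F (insert e₀ S) := fun F => by
    rw [← sum_powerset_insert hnot, insert_erase (mem_univ _), powerset_univ]
  have hmem : ∀ S ∈ (univ.erase e₀).powerset, e₀ ∉ S := fun S hS h =>
    hnot (mem_powerset.1 hS h)
  have hcard : #(univ.erase e₀) = p := by
    rw [card_erase_of_mem (mem_univ _), card_univ, hE, Nat.add_sub_cancel]
  have hW0 := sum_powerset_apply_card f (x := univ.erase e₀)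
  have hW1 := sum_powerset_apply_card (fun k => f (k + 1)) (x := univ.erase e₀)
  rw [hcard] at hW0 hW1
  have hB : ∑ S : Finset E, f #S = ∑ k ∈ range (p + 1), p.choose k • f k +
      ∑ k ∈ range (p + 1), p.choose k • f (k + 1) := by
    rw [hsplit, ← hW0, ← hW1]
    congr 1
    exact sum_congr rfl fun S hS => by rw [card_insert_of_notMem (hmem S hS)]
  rw [pi_bern_apply hq0 hq1, pi_bern_apply hq0 hq1, ← ENNReal.ofReal_mul hc1]
  refine ENNReal.ofReal_le_ofReal ?_
  simp only [Set.mem_ofPred_eq, hE, sum_boole, filter_univ_mem, ite_and]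
  change _ ≤ _ * ∑ S : Finset E, f #S
  change ∑ S : Finset E, (if (if e₀ ∈ S then (1 : ZMod p) else 0) = v then f #S else 0) ≤ _
  rw [hB, hsplit]
  have hA0 : ∑ S ∈ (univ.erase e₀).powerset,
      (if (if e₀ ∈ S then (1 : ZMod p) else 0) = v then f #S else 0) =
      if 0 = v then ∑ k ∈ range (p + 1), p.choose k • f k else 0 := by
    rw [sum_congr rfl fun S hS => by rw [if_neg (hmem S hS)], ← hW0]
    split_ifs <;> simp
  have hA1 : ∑ S ∈ (univ.erase e₀).powerset,
      (if (if e₀ ∈ insert e₀ S then (1 : ZMod p) else 0) = v then f #(insert e₀ S) else 0) =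
      if 1 = v then ∑ k ∈ range (p + 1), p.choose k • f (k + 1) else 0 := by
    rw [sum_congr rfl fun S hS => by
      rw [if_pos (mem_insert_self _ _), card_insert_of_notMem (hmem S hS)], ← hW1]
    split_ifs <;> simp
  rw [hA0, hA1]
  have hS0 : 0 ≤ ∑ k ∈ range (p + 1), p.choose k • f k :=
    sum_nonneg fun k _ => nsmul_nonneg (hf _) _
  have hS1 : 0 ≤ ∑ k ∈ range (p + 1), p.choose k • f (k + 1) :=
    sum_nonneg fun k _ => nsmul_nonneg (hf _) _
  have hne : (0 : ZMod p) ≠ 1 := zero_ne_one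
  split_ifs with h0 h1 h1
  · exact absurd (h0.trans h1.symm) hne
  · linarith
  · linarith
  · rw [add_zero]
    positivity

/-- Overwrite the coordinates of `ω` in `T` by `x`. -/
def overwrite {E V : Type*} [DecidableEq E] (T : Finset E) (ω : E → V) (x : T → V) : E → V :=
  fun e => if h : e ∈ T then x ⟨e, h⟩ else ω e

/-- A bound between events which holds on resampling the coordinates in `T` holds overall. -/
theorem pi_bern_le_of_overwrite {E : Type*} [Fintype E] [DecidableEq E] {p : ℕ} [NeZero p]
    {q : ℝ} (T : Finset E) (A B : Set (E → ZMod p)) (c : ENNReal)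
    (h : ∀ ω : E → ZMod p,
      Measure.pi (fun _ : T => bern p q) {x | overwrite T ω x ∈ A} ≤
        c * Measure.pi (fun _ : T => bern p q) {x | overwrite T ω x ∈ B}) :
    Measure.pi (fun _ : E => bern p q) A ≤ c * Measure.pi (fun _ : E => bern p q) B := by
  have hmp := (measurePreserving_piEquivPiSubtypeProd (fun _ : E => bern p q) (· ∈ T)).symm
  have key : ∀ C : Set (E → ZMod p), Measure.pi (fun _ : E => bern p q) C =
      ∫⁻ y : {e // e ∉ T} → ZMod p, Measure.pi (fun _ : T => bern p q)
        {x | overwrite T (fun e => if h : e ∈ T then 0 else y ⟨e, h⟩) x ∈ C}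
        ∂Measure.pi (fun _ : {e // e ∉ T} => bern p q) := fun C => by
    rw [← hmp.measure_preimage_equiv C, Measure.prod_apply_symm MeasurableSet.of_discrete]
    refine lintegral_congr fun y => ?_
    rw [Subsingleton.elim (Subtype.fintype (· ∈ T)) (Finset.Subtype.fintype T)]
    refine congrArg (Measure.pi fun _ : T => bern p q) (Set.ext fun x => ?_)
    change _ ∈ C ↔ _ ∈ C
    refine iff_of_eq (congrArg (· ∈ C) (funext fun e => ?_))
    by_cases he : e ∈ T <;>
      simp [overwrite, he, MeasurableEquiv.piEquivPiSubtypeProd, Equiv.piEquivPiSubtypeProd]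
  rw [key A, key B, ← lintegral_const_mul _ (measurable_of_countable _)]
  exact lintegral_mono fun y => h _

theorem overwrite_of_notMem {E V : Type*} [DecidableEq E] {T : Finset E} (ω : E → V) (x : T → V)
    {e : E} (he : e ∉ T) : overwrite T ω x e = ω e :=
  dif_neg he

theorem overwrite_of_mem {E V : Type*} [DecidableEq E] {T : Finset E} (ω : E → V) (x : T → V)
    {e : E} (he : e ∈ T) : overwrite T ω x e = x ⟨e, he⟩ :=
  dif_pos he

theorem lapM_diag {p n a : ℕ} (ω : LapIdx n a → ZMod p) {i j : Fin (n + a)} (hi : (i : ℕ) < n)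
    (hij : (j : ℕ) = i) :
    lapM p n a ω i j = -∑ k : Fin a, ω (Sum.inl (⟨i, hi⟩, k)) := by
  simp [lapM, hi, hij]

theorem lapM_right {p n a : ℕ} (ω : LapIdx n a → ZMod p) {i j : Fin (n + a)} (hi : (i : ℕ) < n)
    (hj : n ≤ (j : ℕ)) :
    lapM p n a ω i j = ω (Sum.inl (⟨i, hi⟩, ⟨(j : ℕ) - n, by have := j.isLt; omega⟩)) := by
  simp [lapM, hi, Nat.not_lt.2 hj]

/-- The edges leaving a left vertex, indexed by their right endpoint. -/
def rowEdge {n a : ℕ} (i : Fin n) : Fin a ↪ LapIdx n a :=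
  ⟨fun k => Sum.inl (i, k), fun _ _ h => congrArg Prod.snd (Sum.inl_injective h)⟩

/-- The edges leaving the left vertex `i` towards the right vertices in `K`. -/
def rowEdges {n a : ℕ} (i : Fin n) (K : Finset (Fin a)) : Finset (LapIdx n a) :=
  K.map (rowEdge i)

theorem inl_mem_rowEdges {n a : ℕ} {i i' : Fin n} {K : Finset (Fin a)} {k : Fin a} :
    (Sum.inl (i', k) : LapIdx n a) ∈ rowEdges i K ↔ i' = i ∧ k ∈ K := by
  rw [rowEdges, Finset.mem_map]
  refine ⟨fun ⟨k', hk', h⟩ => ?_, fun ⟨hi, hk⟩ => ⟨k, hk, hi ▸ rfl⟩⟩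
  obtain ⟨rfl, rfl⟩ := Prod.mk.inj (Sum.inl_injective h)
  exact ⟨rfl, hk'⟩

theorem sum_row_overwrite {p n a : ℕ} (i : Fin n) (K : Finset (Fin a)) (ω : LapIdx n a → ZMod p)
    (x : rowEdges i K → ZMod p) :
    ∑ k : Fin a, overwrite (rowEdges i K) ω x (Sum.inl (i, k)) =
      ∑ k ∈ Finset.univ \ K, ω (Sum.inl (i, k)) + ∑ e, x e := by
  rw [← Finset.sum_sdiff (Finset.subset_univ K)]
  congr 1
  · refine Finset.sum_congr rfl fun k hk => overwrite_of_notMem ω x fun h => ?_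
    exact (Finset.mem_sdiff.1 hk).2 (inl_mem_rowEdges.1 h).2
  · have h := Finset.sum_coe_sort (rowEdges i K) (overwrite (rowEdges i K) ω x)
    rw [show ∑ e : rowEdges i K, x e = ∑ e : rowEdges i K, overwrite (rowEdges i K) ω x e from
      Finset.sum_congr rfl fun e _ => (overwrite_of_mem ω x e.2).symm, h]
    exact (Finset.sum_map K (rowEdge i) _).symm

/-- Entries of the top rows not involving the overwritten edges are unchanged. -/
theorem lapM_overwrite {p n a : ℕ} (i : Fin n) (K : Finset (Fin a)) (ω : LapIdx n a → ZMod p)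
    (x : rowEdges i K → ZMod p) {r c : Fin (n + a)} (hr : (r : ℕ) < n)
    (h : ((c : ℕ) = r ∧ (r : ℕ) ≠ i) ∨
      (n ≤ (c : ℕ) ∧ ∀ k ∈ K, (r : ℕ) = i → (c : ℕ) ≠ n + k)) :
    lapM p n a (overwrite (rowEdges i K) ω x) r c = lapM p n a ω r c := by
  rcases h with ⟨hc, hri⟩ | ⟨hc, hK⟩
  · rw [lapM_diag _ hr hc, lapM_diag _ hr hc]
    refine congrArg _ (Finset.sum_congr rfl fun k _ => overwrite_of_notMem ω x fun hmem => ?_)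
    exact hri (congrArg Fin.val (inl_mem_rowEdges.1 hmem).1)
  · rw [lapM_right _ hr hc, lapM_right _ hr hc]
    refine overwrite_of_notMem ω x fun hmem => ?_
    obtain ⟨h1, h2⟩ := inl_mem_rowEdges.1 hmem
    exact hK _ h2 (congrArg Fin.val h1) (by simp only; omega)

/-- The diagonal entries of the top `n` rows of the Laplacian, together with the entries in
columns `n+1` through `(1+α)n - p` (here `0`-indexed: columns `n ≤ j < n + a - p`),
have min-entropy `min(q, 1-q)^p`. -/
theorem minEntropy_laplacian_top_rows
    (p : ℕ) (hp : p.Prime) (q : ℝ) (hq0 : 0 < q) (hq1 : q < 1)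
    (α : ℚ) (hα1 : 1 / (p : ℚ) < α) (hα2 : α ≤ 1)
    (n : ℕ) (hn : 0 < n) (a : ℕ) (ha : (a : ℚ) = α * n) (hap : p < a) :
    HasMinEntropySet (lapMeasure p n a q)
      {ij : Fin (n + a) × Fin (n + a) |
        (ij.1 : ℕ) < n ∧
          ((ij.2 : ℕ) = (ij.1 : ℕ) ∨ (n ≤ (ij.2 : ℕ) ∧ (ij.2 : ℕ) < n + a - p))}
      (fun ij ω => lapM p n a ω ij.1 ij.2)
      (min q (1 - q) ^ p) := by
  have : Fact p.Prime := ⟨hp⟩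
  rintro ⟨i, j⟩ ⟨hi, hij⟩ v y -
  simp only at hi hij
  let k₀ : Fin a := ⟨a - p, by have := hp.pos; omega⟩
  have hk₀ : ∀ k ∈ Finset.Ici k₀, a - p ≤ (k : ℕ) := fun k hk =>
    Fin.le_def.1 (Finset.mem_Ici.1 hk)
  have hcard : (Finset.Ici k₀).card = p := by
    rw [Fin.card_Ici]
    exact Nat.sub_sub_self hap.le
  rcases hij with hij | ⟨hj, hjp⟩
  · refine pi_bern_le_of_overwrite (rowEdges ⟨i, hi⟩ (Finset.Ici k₀)) _ _ _ fun ω => ?_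
    have hother : ∀ x, ∀ rc : Fin (n + a) × Fin (n + a), ((rc.1 : ℕ) < n ∧
        ((rc.2 : ℕ) = rc.1 ∨ (n ≤ (rc.2 : ℕ) ∧ (rc.2 : ℕ) < n + a - p))) → rc ≠ (i, j) →
        lapM p n a (overwrite (rowEdges ⟨i, hi⟩ (Finset.Ici k₀)) ω x) rc.1 rc.2 =
          lapM p n a ω rc.1 rc.2 := by
      rintro x ⟨r, c⟩ ⟨hr, hc⟩ hne
      refine lapM_overwrite _ _ _ _ hr (hc.imp (fun h => ⟨h, fun hri => hne ?_⟩)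
        fun h => ⟨h.1, fun k hk _ => ?_⟩)
      · simp only at h hri
        exact Prod.ext (Fin.ext hri) (Fin.ext (by simp only; omega))
      · have := hk₀ k hk
        simp only at h ⊢
        omega
    by_cases hQ : ∀ rc : Fin (n + a) × Fin (n + a), ((rc.1 : ℕ) < n ∧
        ((rc.2 : ℕ) = rc.1 ∨ (n ≤ (rc.2 : ℕ) ∧ (rc.2 : ℕ) < n + a - p))) → rc ≠ (i, j) →
        lapM p n a ω rc.1 rc.2 = y rc
    · refine (measure_mono ?_).trans ((pi_bern_sum_eq_le hp hq0.le hq1.le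
        (by rw [Fintype.card_coe, rowEdges, Finset.card_map, hcard])
        (-v - ∑ k ∈ Finset.univ \ Finset.Ici k₀, ω (Sum.inl (⟨i, hi⟩, k)))).trans
          (mul_le_mul_right (measure_mono ?_) _))
      · rintro x ⟨hx, -⟩
        change lapM p n a _ i j = v at hx
        rw [lapM_diag _ hi hij, sum_row_overwrite] at hx
        change ∑ e, x e = _
        rw [← hx]
        ring
      · intro x _ rc hrc hne
        exact (hother x rc hrc hne).trans (hQ rc hrc hne)
    · refine le_of_eq_of_le (measure_mono_null ?_ measure_empty) zero_le
      rintro x ⟨-, hx⟩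
      exact hQ fun rc hrc hne => (hother x rc hrc hne).symm.trans (hx rc hrc hne)
  · let k₁ : Fin a := ⟨(j : ℕ) - n, by have := j.isLt; omega⟩
    have hk₁ : k₁ ∉ Finset.Ici k₀ := fun h => by
      have h' : a - p ≤ (j : ℕ) - n := hk₀ _ h
      omega
    let K := insert k₁ (Finset.Ici k₀)
    have hK : K.card = p + 1 := by rw [Finset.card_insert_of_notMem hk₁, hcard]
    refine pi_bern_le_of_overwrite (rowEdges ⟨i, hi⟩ K) _ _ _ fun ω => ?_
    have hother : ∀ x, ∀ rc : Fin (n + a) × Fin (n + a), ((rc.1 : ℕ) < n ∧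
        ((rc.2 : ℕ) = rc.1 ∨ (n ≤ (rc.2 : ℕ) ∧ (rc.2 : ℕ) < n + a - p))) → rc ≠ (i, j) →
        rc ≠ (i, i) →
        lapM p n a (overwrite (rowEdges ⟨i, hi⟩ K) ω x) rc.1 rc.2 =
          lapM p n a ω rc.1 rc.2 := by
      rintro x ⟨r, c⟩ ⟨hr, hc⟩ hne hne'
      refine lapM_overwrite _ _ _ _ hr (hc.imp (fun h => ⟨h, fun hri => hne' ?_⟩)
        fun h => ⟨h.1, fun k hk hri hck => ?_⟩)
      · simp only at h hri
        exact Prod.ext (Fin.ext hri) (Fin.ext (by simp only; omega))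
      · simp only at h hri hck
        rcases Finset.mem_insert.1 hk with rfl | hk
        · refine hne (Prod.ext (Fin.ext hri) (Fin.ext ?_))
          simp only [hck, k₁]
          omega
        · have := hk₀ k hk
          omega
    have hmem : (Sum.inl (⟨i, hi⟩, k₁) : LapIdx n a) ∈ rowEdges ⟨i, hi⟩ K :=
      inl_mem_rowEdges.2 ⟨rfl, Finset.mem_insert_self _ _⟩
    have hdiag : (i, i) ≠ (i, j) := fun h => by
      have : (i : ℕ) = j := congrArg (fun rc => (rc.2 : ℕ)) h
      omega
    have hsum : ∀ x, lapM p n a (overwrite (rowEdges ⟨i, hi⟩ K) ω x) i i = y (i, i) ↔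
        ∑ e, x e = -y (i, i) - ∑ k ∈ Finset.univ \ K, ω (Sum.inl (⟨i, hi⟩, k)) := fun x => by
      rw [lapM_diag _ hi rfl, sum_row_overwrite, neg_eq_iff_eq_neg, eq_sub_iff_add_eq, add_comm]
    by_cases hQ : ∀ rc : Fin (n + a) × Fin (n + a), ((rc.1 : ℕ) < n ∧
        ((rc.2 : ℕ) = rc.1 ∨ (n ≤ (rc.2 : ℕ) ∧ (rc.2 : ℕ) < n + a - p))) → rc ≠ (i, j) →
        rc ≠ (i, i) → lapM p n a ω rc.1 rc.2 = y rc
    · refine (measure_mono ?_).trans ((pi_bern_coord_and_sum_eq_le hp hq0.le hq1.le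
        (by rw [Fintype.card_coe, rowEdges, Finset.card_map, hK])
        ⟨_, hmem⟩ v
        (-y (i, i) - ∑ k ∈ Finset.univ \ K, ω (Sum.inl (⟨i, hi⟩, k)))).trans
          (mul_le_mul_right (measure_mono ?_) _))
      · rintro x ⟨hx, hx'⟩
        change lapM p n a _ i j = v at hx
        rw [lapM_right _ hi hj, overwrite_of_mem ω x hmem] at hx
        exact ⟨hx, (hsum x).1 (hx' (i, i) ⟨hi, Or.inl rfl⟩ hdiag)⟩
      · intro x hx rc hrc hne
        by_cases hrc' : rc = (i, i)
        · subst hrc'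
          exact (hsum x).2 hx
        · exact (hother x rc hrc hne hrc').trans (hQ rc hrc hne hrc')
    · refine le_of_eq_of_le (measure_mono_null ?_ measure_empty) zero_le
      rintro x ⟨-, hx⟩
      exact hQ fun rc hrc hne hne' => (hother x rc hrc hne hne').symm.trans (hx rc hrc hne)
end

section
/- In the Laplacian model, there exist constants C, c > 0 (depending on p, q, α) such that for all n, the matrix M_n consisting of the first n rows of M has full row rank n over F_p with probability at least 1 − C·exp(−cn). -/
open MeasureTheory

open Filter Topology

section Weights

open scoped Classical

/-- Odlyzko's bound: a vector with independent entries, none of whose atoms has mass exceeding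
`β`, lies in a given subspace with probability at most `β` to the power its codimension. -/
lemma sum_prod_mem_submodule_le {F ι : Type*} [Field F] [Fintype F] [Fintype ι] [DecidableEq ι]
    {b : F → ℝ} {β : ℝ} (hb0 : ∀ x, 0 ≤ b x) (hb1 : ∑ x, b x = 1) (hbβ : ∀ x, b x ≤ β)
    (V : Submodule F (ι → F)) :
    ∑ x : ι → F with x ∈ V, ∏ j, b (x j) ≤ β ^ (Fintype.card ι - Module.finrank F V) := by
  have hβ0 : 0 ≤ β := (hb0 0).trans (hbβ 0)
  let φ : ι → Module.Dual F V := fun j => (LinearMap.proj j).comp V.subtype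
  obtain ⟨κ, e, he, hspan, hli⟩ := exists_linearIndependent' F φ
  have : Fintype κ := Fintype.ofInjective e he
  have hker : ∀ v : V, (∀ k, v.1 (e k) = 0) → v = 0 := by
    intro v hv
    ext j
    have hj : φ j ∈ Submodule.span F (Set.range (φ ∘ e)) :=
      hspan ▸ Submodule.subset_span ⟨j, rfl⟩
    have hle : Submodule.span F (Set.range (φ ∘ e)) ≤ LinearMap.ker (Module.Dual.eval F V v) := by
      rw [Submodule.span_le]
      rintro _ ⟨k, rfl⟩
      exact hv k
    exact hle hj
  have hcard : Fintype.card κ = Module.finrank F V := by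
    apply le_antisymm
    · have := hli.fintype_card_le_finrank
      rwa [Subspace.dual_finrank_eq] at this
    · let f : V →ₗ[F] (κ → F) := LinearMap.pi fun k => φ (e k)
      have hf : Function.Injective f := by
        rw [injective_iff_map_eq_zero]
        intro v hv
        exact hker v fun k => congrFun hv k
      simpa using LinearMap.finrank_le_finrank_of_injective hf
  let J : Finset ι := Finset.univ.map ⟨e, he⟩
  have hJ : J.card = Module.finrank F V := by simp [J, hcard]
  calc ∑ x : ι → F with x ∈ V, ∏ j, b (x j)
      ≤ ∑ x : ι → F with x ∈ V,
          β ^ (Fintype.card ι - Module.finrank F V) * ∏ k, b (x (e k)) := by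
        refine Finset.sum_le_sum fun x _ => ?_
        rw [← Finset.prod_compl_mul_prod J]
        refine mul_le_mul ?_ (by simp [J]) (Finset.prod_nonneg fun _ _ => hb0 _) (by positivity)
        calc ∏ j ∈ Jᶜ, b (x j) ≤ ∏ j ∈ Jᶜ, β :=
              Finset.prod_le_prod (fun _ _ => hb0 _) fun _ _ => hbβ _
          _ = _ := by rw [Finset.prod_const, Finset.card_compl, hJ]
    _ = β ^ (Fintype.card ι - Module.finrank F V) *
          ∑ x : ι → F with x ∈ V, ∏ k, b (x (e k)) := by rw [Finset.mul_sum]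
    _ ≤ β ^ (Fintype.card ι - Module.finrank F V) * 1 := by
        refine mul_le_mul_of_nonneg_left ?_ (by positivity)
        have hinj : Set.InjOn (fun (x : ι → F) k => x (e k))
            (Finset.univ.filter (· ∈ V) : Finset (ι → F)) := by
          intro x hx y hy hxy
          simp only [Finset.coe_filter, Finset.mem_univ, true_and, Set.mem_ofPred_eq] at hx hy
          have := hker ⟨x - y, V.sub_mem hx hy⟩ fun k => by
            simpa [sub_eq_zero] using congrFun hxy k
          simpa [sub_eq_zero] using this
        rw [← Finset.sum_image (f := fun y : κ → F => ∏ k, b (y k)) hinj]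
        calc _ ≤ ∑ y : κ → F, ∏ k, b (y k) :=
              Finset.sum_le_univ_sum_of_nonneg fun _ => Finset.prod_nonneg fun _ _ => hb0 _
          _ = 1 := by rw [← Fintype.prod_sum (fun _ : κ => b)]; simp [hb1]
    _ = _ := mul_one _

/-- An event whose conditional probability given all coordinates but one is at most `ε` has
probability at most `ε`. -/
lemma sum_prod_le_of_update {ι R : Type*} [Fintype ι] [DecidableEq ι] [Fintype R] {w : R → ℝ}
    (hw0 : ∀ r, 0 ≤ w r) (hw1 : ∑ r, w r = 1) (i : ι) (P : (ι → R) → Prop)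
    [DecidablePred P] {ε : ℝ}
    (h : ∀ X, ∑ r with P (Function.update X i r), w r ≤ ε) :
    ∑ X with P X, ∏ j, w (X j) ≤ ε := by
  have key : ∀ (r : R) (y : {j // j ≠ i} → R) (X : ι → R),
      (Equiv.funSplitAt i R).symm (r, y) =
        Function.update ((Equiv.funSplitAt i R).symm (X i, y)) i r := by
    intro r y X
    ext j
    by_cases hj : j = i
    · subst hj; simp
    · simp [hj]
  rcases isEmpty_or_nonempty R with hR | ⟨⟨r₀⟩⟩
  · simp at hw1
  rw [Finset.sum_filter, ← (Equiv.funSplitAt i R).symm.sum_comp, Fintype.sum_prod_type_right]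
  calc _ = ∑ y : {j // j ≠ i} → R, (∏ j, w (y j)) *
        ∑ r with P (Function.update ((Equiv.funSplitAt i R).symm (r₀, y)) i r), w r := by
        refine Finset.sum_congr rfl fun y _ => ?_
        rw [Finset.sum_filter, Finset.mul_sum]
        refine Finset.sum_congr rfl fun r _ => ?_
        rw [← key r y (fun _ => r₀), Fintype.prod_eq_mul_prod_subtype_ne _ i]
        have : ∀ j : {j // j ≠ i}, (Equiv.funSplitAt i R).symm (r, y) j = y j := by
          rintro ⟨j, hj⟩; simp [hj]
        simp only [this]
        simp [mul_comm]
    _ ≤ ∑ y : {j // j ≠ i} → R, (∏ j, w (y j)) * ε :=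
        Finset.sum_le_sum fun y _ =>
          mul_le_mul_of_nonneg_left (h _) (Finset.prod_nonneg fun _ _ => hw0 _)
    _ = ε := by
        rw [← Finset.sum_mul, ← Fintype.prod_sum (fun _ : {j // j ≠ i} => w)]; simp [hw1]

/-- Chernoff's bound for the number of coordinates lying in a given set. -/
lemma sum_prod_card_gt_le {ι R : Type*} [Fintype ι] [DecidableEq ι] [Fintype R] {w : R → ℝ}
    (hw0 : ∀ r, 0 ≤ w r) (hw1 : ∑ r, w r = 1) (A : R → Prop)
    [DecidablePred A] {γ t m : ℝ}
    (hA : ∑ r with A r, w r ≤ γ) (ht : 1 ≤ t) :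
    ∑ X : ι → R with m ≤ (Finset.univ.filter fun i => A (X i)).card, ∏ j, w (X j)
      ≤ (1 + (t - 1) * γ) ^ Fintype.card ι / t ^ m := by
  have ht0 : 0 < t := by linarith
  have htm : 0 < t ^ m := Real.rpow_pos_of_pos ht0 m
  rw [le_div_iff₀ htm, Finset.sum_mul]
  calc _ ≤ ∑ X : ι → R, ∏ j, (w (X j) * if A (X j) then t else 1) := by
        refine (Finset.sum_le_sum fun X hX => ?_).trans
          (Finset.sum_le_univ_sum_of_nonneg fun X => Finset.prod_nonneg fun j _ => ?_)
        · rw [Finset.prod_mul_distrib, Finset.prod_ite, Finset.prod_const, Finset.prod_const,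
            one_pow, mul_one, ← Real.rpow_natCast]
          exact mul_le_mul_of_nonneg_left
            (Real.rpow_le_rpow_of_exponent_le ht (Finset.mem_filter.1 hX).2)
            (Finset.prod_nonneg fun _ _ => hw0 _)
        · exact mul_nonneg (hw0 _) (by split_ifs <;> linarith)
    _ = (∑ r, w r * if A r then t else 1) ^ Fintype.card ι := by
        rw [← Fintype.prod_sum (fun (_ : ι) r => w r * if A r then t else 1)]; simp
    _ ≤ _ := by
        have h : ∑ r, (w r * if A r then t else 1) = 1 + (t - 1) * ∑ r with A r, w r := by
          rw [show (1 : ℝ) + (t - 1) * ∑ r with A r, w r = ∑ r, w r + (t - 1) * ∑ r with A r, w r by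
            rw [hw1], Finset.mul_sum, Finset.sum_filter, ← Finset.sum_add_distrib]
          refine Finset.sum_congr rfl fun r _ => ?_
          split_ifs <;> ring
        refine pow_le_pow_left₀ (Finset.sum_nonneg fun r _ =>
          mul_nonneg (hw0 _) (by split_ifs <;> linarith)) ?_ _
        rw [h]
        gcongr

lemma finrank_span_image_le_card {F M ι : Type*} [DivisionRing F] [AddCommGroup M] [Module F M]
    (X : ι → M) {s : Set ι} {T : Finset ι} (h : s ⊆ T) :
    Module.finrank F (Submodule.span F (X '' s)) ≤ T.card := by
  have hle : Submodule.span F (X '' s) ≤ Submodule.span F (T.image X : Set M) := by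
    rw [Finset.coe_image]
    exact Submodule.span_mono (Set.image_mono h)
  exact (Submodule.finrank_mono hle).trans
    ((finrank_span_finset_le_card (T.image X)).trans Finset.card_image_le)

/-- Some row of `X` lies in the span of those other rows whose entries sum to zero. -/
def HasDependentRow {F ι κ : Type*} [Field F] [Fintype κ] (X : ι → κ → F) : Prop :=
  ∃ i, X i ∈ Submodule.span F (X '' {j | j ≠ i ∧ ∑ k, X j k = 0})

/-- If the rows of a matrix that sum to zero are dependent, one of them is in the span of the
others. The hypothesis says that `g` is in the left kernel of the first rows of a Laplacian. -/
lemma hasDependentRow_of_dependent {F ι κ : Type*} [Field F] [Fintype ι] [Fintype κ]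
    {X : ι → κ → F} {g : ι → F} (hg : g ≠ 0) (hgs : ∀ i, g i * ∑ k, X i k = 0)
    (hgX : ∑ i, g i • X i = 0) :
    HasDependentRow X := by
  obtain ⟨i, hi⟩ := Function.ne_iff.1 hg
  refine ⟨i, ?_⟩
  rw [← Finset.add_sum_erase _ _ (Finset.mem_univ i), add_eq_zero_iff_eq_neg] at hgX
  have : g i • X i ∈ Submodule.span F (X '' {j | j ≠ i ∧ ∑ k, X j k = 0}) := by
    rw [hgX]
    refine Submodule.neg_mem _ (Submodule.sum_mem _ fun j hj => ?_)
    by_cases hgj : g j = 0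
    · simp [hgj]
    · exact Submodule.smul_mem _ _ (Submodule.subset_span ⟨j, ⟨Finset.ne_of_mem_erase hj,
        (mul_eq_zero.1 (hgs j)).resolve_left hgj⟩, rfl⟩)
  exact (Submodule.smul_mem_iff _ hi).1 this

end Weights

lemma bern_real_singleton {p : ℕ} {q : ℝ} (hq0 : 0 ≤ q) (hq1 : q ≤ 1) (x : ZMod p) :
    (bern p q).real {x} = (if x = 1 then q else 0) + (if x = 0 then 1 - q else 0) := by
  have h : 0 ≤ 1 - q := by linarith
  simp only [bern, Measure.real, Measure.add_apply, Measure.smul_apply, smul_eq_mul,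
    Measure.dirac_apply, Set.indicator_apply, Set.mem_singleton_iff, Pi.one_apply, mul_ite,
    mul_one, mul_zero, eq_comm (b := x)]
  split_ifs <;> simp [hq0, h, ENNReal.toReal_add]

lemma bern_real_singleton_le {p : ℕ} [Fact p.Prime] {q : ℝ} (hq0 : 0 ≤ q) (hq1 : q ≤ 1)
    (x : ZMod p) : (bern p q).real {x} ≤ max q (1 - q) := by
  rw [bern_real_singleton hq0 hq1]
  split_ifs with h1 h0
  · exact absurd (h1.symm.trans h0) one_ne_zero
  all_goals simp [hq0, hq1]

lemma sum_bern_real_smul {p : ℕ} [NeZero p] {q : ℝ} (hq0 : 0 ≤ q) (hq1 : q ≤ 1)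
    (f : ZMod p → ℂ) :
    ∑ x, ((bern p q).real {x} : ℂ) * f x = q * f 1 + (1 - q) * f 0 := by
  simp only [bern_real_singleton hq0 hq1]
  simp [apply_ite Complex.ofReal, add_mul, Finset.sum_add_distrib]

lemma bern_isProbabilityMeasure {p : ℕ} {q : ℝ} (hq0 : 0 ≤ q) (hq1 : q ≤ 1) :
    IsProbabilityMeasure (bern p q) := by
  constructor
  have h : 0 ≤ 1 - q := by linarith
  simp [bern, ← ENNReal.ofReal_add hq0 h]

lemma sum_bern_real {p : ℕ} [NeZero p] {q : ℝ} (hq0 : 0 ≤ q) (hq1 : q ≤ 1) :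
    ∑ x, (bern p q).real {x} = 1 := by
  have := bern_isProbabilityMeasure (p := p) hq0 hq1
  simp

lemma addChar_sum {A R ι : Type*} [AddCommMonoid A] [CommMonoid R] (ψ : AddChar A R)
    (s : Finset ι) (f : ι → A) : ψ (∑ i ∈ s, f i) = ∏ i ∈ s, ψ (f i) :=
  map_prod ψ.toMonoidHom (fun i => Multiplicative.ofAdd (f i)) s

section Equidistribution

open scoped Classical

open ZMod in
/-- The probability that a sum of `a` independent Bernoulli variables vanishes modulo `p`. -/
lemma sum_prod_bern_sum_eq_zero {p : ℕ} [Fact p.Prime] {q : ℝ} (hq0 : 0 ≤ q) (hq1 : q ≤ 1)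
    (a : ℕ) :
    ((∑ x : Fin a → ZMod p with ∑ k, x k = 0, ∏ k, (bern p q).real {x k} : ℝ) : ℂ) =
      (p : ℂ)⁻¹ * ∑ y : ZMod p, (q * stdAddChar y + (1 - q)) ^ a := by
  have hp : (p : ℂ) ≠ 0 := by exact_mod_cast (Fact.out : p.Prime).ne_zero
  rw [eq_inv_mul_iff_mul_eq₀ hp, Finset.sum_filter]
  push_cast
  have h : ∀ y : ZMod p, (q * stdAddChar y + (1 - q) : ℂ) ^ a =
      ∑ x : Fin a → ZMod p, (∏ k, ((bern p q).real {x k} : ℂ)) * stdAddChar (y * ∑ k, x k) := by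
    intro y
    have := sum_bern_real_smul hq0 hq1 fun x : ZMod p => stdAddChar (y * x)
    simp only [mul_one, mul_zero, AddChar.map_zero_eq_one] at this
    rw [← this]
    have h2 := Fintype.prod_sum fun (_ : Fin a) (x : ZMod p) =>
      ((bern p q).real {x} : ℂ) * stdAddChar (y * x)
    rw [Finset.prod_const, Finset.card_univ, Fintype.card_fin] at h2
    rw [h2]
    refine Finset.sum_congr rfl fun x _ => ?_
    rw [Finset.prod_mul_distrib, Finset.mul_sum, addChar_sum]
  rw [Finset.sum_congr rfl fun y _ => h y, Finset.sum_comm, Finset.mul_sum]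
  refine Finset.sum_congr rfl fun x _ => ?_
  rw [← Finset.mul_sum, AddChar.sum_mulShift _ (isPrimitive_stdAddChar p), ZMod.card]
  split_ifs <;> push_cast <;> ring

open ZMod in
lemma norm_bern_char_lt_one {p : ℕ} [Fact p.Prime] {q : ℝ} (hq0 : 0 < q) (hq1 : q < 1)
    {y : ZMod p} (hy : y ≠ 0) : ‖(q * stdAddChar y + (1 - q) : ℂ)‖ < 1 := by
  have hne : (stdAddChar y : ℂ) ≠ 1 := by
    rw [← AddChar.map_zero_eq_one (stdAddChar (N := p))]
    exact injective_stdAddChar.ne hy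
  have := norm_combo_lt_of_ne (AddChar.norm_apply (stdAddChar (N := p)) y).le norm_one.le hne hq0
    (by linarith : 0 < 1 - q) (by ring)
  simpa using this

open ZMod in
lemma tendsto_sum_prod_bern_sum_eq_zero {p : ℕ} [Fact p.Prime] {q : ℝ} (hq0 : 0 < q)
    (hq1 : q < 1) :
    Tendsto (fun a : ℕ => ∑ x : Fin a → ZMod p with ∑ k, x k = 0, ∏ k, (bern p q).real {x k})
      atTop (𝓝 (p : ℝ)⁻¹) := by
  rw [← Filter.tendsto_ofReal_iff]
  simp only [sum_prod_bern_sum_eq_zero hq0.le hq1.le]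
  have h : ∀ y : ZMod p, Tendsto (fun a : ℕ => (q * stdAddChar y + (1 - q) : ℂ) ^ a) atTop
      (𝓝 (if y = 0 then 1 else 0)) := by
    intro y
    split_ifs with hy
    · simp [hy]
    · exact tendsto_pow_atTop_nhds_zero_of_norm_lt_one (norm_bern_char_lt_one hq0 hq1 hy)
  simpa using (tendsto_finsetSum Finset.univ fun y _ => h y).const_mul (p : ℂ)⁻¹

end Equidistribution

section Laplacian

open scoped Classical

lemma toReal_pi_apply_eq_sum {ι Ω : Type*} [Fintype ι] [DecidableEq ι] [Fintype Ω] [MeasurableSpace Ω]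
    [MeasurableSingletonClass Ω] (μ : Measure Ω) [IsProbabilityMeasure μ] (S : Set (ι → Ω)) :
    (Measure.pi (fun _ : ι => μ) S).toReal = ∑ ω with ω ∈ S, ∏ i, μ.real {ω i} := by
  have := sum_measureReal_singleton (μ := Measure.pi (fun _ : ι => μ))
    (Finset.univ.filter (· ∈ S))
  simp only [Finset.coe_filter, Finset.mem_univ, true_and, Set.ofPred_mem_eq] at this
  rw [← Measure.real, ← this]
  refine Finset.sum_congr rfl fun ω _ => ?_
  simp [Measure.real, Measure.pi_singleton, ENNReal.toReal_prod]

/-- The rows of the upper right block of the Laplacian, as a function of the edge indicators. -/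
def edgeRows {n a : ℕ} {F : Type*} (ω : LapIdx n a → F) : Fin n → Fin a → F :=
  fun i k => ω (Sum.inl (i, k))

lemma lapMeasure_edgeRows {p : ℕ} [Fact p.Prime] {q : ℝ} (hq0 : 0 ≤ q) (hq1 : q ≤ 1) (n a : ℕ)
    (E : (Fin n → Fin a → ZMod p) → Prop) :
    (lapMeasure p n a q {ω | E (edgeRows ω)}).toReal =
      ∑ X with E X, ∏ i, ∏ k, (bern p q).real {X i k} := by
  have := bern_isProbabilityMeasure (p := p) hq0 hq1
  rw [lapMeasure, toReal_pi_apply_eq_sum, Finset.sum_filter, Finset.sum_filter,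
    ← ((Equiv.sumArrowEquivProdArrow _ _ _).trans
      ((Equiv.curry (Fin n) (Fin a) (ZMod p)).prodCongr (Equiv.refl _))).symm.sum_comp,
    Fintype.sum_prod_type]
  refine Finset.sum_congr rfl fun X _ => ?_
  have hX : ∀ y : Fin a × Fin n → ZMod p, edgeRows (((Equiv.sumArrowEquivProdArrow _ _ _).trans
      ((Equiv.curry (Fin n) (Fin a) (ZMod p)).prodCongr (Equiv.refl _))).symm (X, y)) = X := by
    intro y; rfl
  simp only [Set.mem_ofPred_eq, hX]
  split_ifs with h
  · simp only [Fintype.prod_sum_type, Fintype.prod_prod_type]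
    have hy := Fintype.prod_sum fun (_ : Fin a × Fin n) (x : ZMod p) => (bern p q).real {x}
    simp only [sum_bern_real hq0 hq1, Finset.prod_const_one, Fintype.prod_prod_type] at hy
    calc _ = ∑ y : Fin a × Fin n → ZMod p, (∏ i, ∏ k, (bern p q).real {X i k}) *
          ∏ i, ∏ k, (bern p q).real {y (i, k)} := rfl
      _ = _ := by rw [← Finset.mul_sum, ← hy, mul_one]
  · simp

lemma hasDependentRow_of_rank_ne {p : ℕ} [Fact p.Prime] {n a : ℕ} {ω : LapIdx n a → ZMod p}
    (h : (firstRows p n a n (Nat.le_add_right n a) ω).rank ≠ n) :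
    HasDependentRow (edgeRows ω) := by
  set M := firstRows p n a n (Nat.le_add_right n a) ω with hM
  have hli : ¬ LinearIndependent (ZMod p) M.row := fun hli =>
    h (by simpa using hli.rank_matrix)
  rw [Fintype.not_linearIndependent_iff] at hli
  obtain ⟨g, hg, i, hi⟩ := hli
  refine hasDependentRow_of_dependent (g := g) (fun h0 => hi (congrFun h0 i)) (fun j => ?_) ?_
  · have := congrFun hg (Fin.castAdd a j)
    simp only [Finset.sum_apply, Pi.smul_apply, smul_eq_mul, Pi.zero_apply] at this
    rw [Finset.sum_eq_single j] at this
    · simpa [hM, Matrix.row, firstRows, lapM, edgeRows] using this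
    · intro b _ hb
      simp [hM, Matrix.row, firstRows, lapM, Fin.val_ne_of_ne hb]
    · simp
  · ext k
    have := congrFun hg (Fin.natAdd n k)
    simpa [hM, Matrix.row, firstRows, lapM, edgeRows] using this

lemma sum_prod_hasDependentRow_le {F : Type*} [Field F] [Fintype F] [DecidableEq F] {n a : ℕ}
    {b : F → ℝ} {β γ δ t : ℝ}
    (hb0 : ∀ x, 0 ≤ b x) (hb1 : ∑ x, b x = 1) (hbβ : ∀ x, b x ≤ β) (hβ0 : 0 < β) (hβ1 : β ≤ 1)
    (hγ : ∑ x : Fin a → F with ∑ k, x k = 0, ∏ k, b (x k) ≤ γ) (ht : 1 ≤ t) :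
    ∑ X : Fin n → Fin a → F with HasDependentRow X, ∏ i, ∏ k, b (X i k)
      ≤ n * β ^ (a - δ * n) + ((1 + (t - 1) * γ) / t ^ δ) ^ n := by
  have hw0 : ∀ r : Fin a → F, 0 ≤ ∏ k, b (r k) := fun r => Finset.prod_nonneg fun _ _ => hb0 _
  have hw1 : ∑ r : Fin a → F, ∏ k, b (r k) = 1 := by
    rw [← Fintype.prod_sum (fun _ : Fin a => b)]; simp [hb1]
  set V : Fin n → (Fin n → Fin a → F) → Submodule F (Fin a → F) := fun i X =>
    Submodule.span F (X '' {j | j ≠ i ∧ ∑ k, X j k = 0}) with hV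
  have hVupd : ∀ i X r, V i (Function.update X i r) = V i X := by
    intro i X r
    have hj : ∀ j, j ≠ i → Function.update X i r j = X j := fun j h =>
      Function.update_of_ne h _ _
    have hset : {j | j ≠ i ∧ ∑ k, Function.update X i r j k = 0} =
        {j | j ≠ i ∧ ∑ k, X j k = 0} :=
      Set.ext fun j => and_congr_right fun h => by rw [hj j h]
    simp only [hV, hset]
    rw [Set.image_congr fun j h => hj j h.1]
  have hVcard : ∀ i X,
      Module.finrank F (V i X) ≤ (Finset.univ.filter fun j => ∑ k, X j k = 0).card := by
    intro i X
    exact finrank_span_image_le_card X fun j hj => by simpa using hj.2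
  have hspan : ∀ i, ∑ X : Fin n → Fin a → F with
      X i ∈ V i X ∧ (Module.finrank F (V i X) : ℝ) ≤ δ * n, ∏ i, ∏ k, b (X i k)
        ≤ β ^ (a - δ * n) := by
    intro i
    refine sum_prod_le_of_update hw0 hw1 i
      (fun X => X i ∈ V i X ∧ (Module.finrank F (V i X) : ℝ) ≤ δ * n) fun X => ?_
    have hP : ∀ r, (Function.update X i r i ∈ V i (Function.update X i r) ∧
        (Module.finrank F (V i (Function.update X i r)) : ℝ) ≤ δ * n) ↔
          r ∈ V i X ∧ (Module.finrank F (V i X) : ℝ) ≤ δ * n := fun r => by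
      rw [hVupd, Function.update_self]
    rw [Finset.filter_congr fun r _ => hP r]
    by_cases hd : (Module.finrank F (V i X) : ℝ) ≤ δ * n
    · simp only [hd, and_true]
      refine (sum_prod_mem_submodule_le hb0 hb1 hbβ (V i X)).trans ?_
      rw [← Real.rpow_natCast]
      refine Real.rpow_le_rpow_of_exponent_ge hβ0 hβ1 ?_
      have hle : Module.finrank F (V i X) ≤ a := by simpa using Submodule.finrank_le (V i X)
      rw [Fintype.card_fin, Nat.cast_sub hle]
      linarith
    · simp only [hd, and_false, Finset.filter_false, Finset.sum_empty]
      positivity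
  have hcount := sum_prod_card_gt_le (ι := Fin n) (m := δ * n) hw0 hw1
    (fun r : Fin a → F => ∑ k, r k = 0) hγ ht
  rw [Fintype.card_fin, Real.rpow_mul (by linarith), Real.rpow_natCast, ← div_pow] at hcount
  calc _ ≤ ∑ i, ∑ X : Fin n → Fin a → F with
        X i ∈ V i X ∧ (Module.finrank F (V i X) : ℝ) ≤ δ * n, ∏ i, ∏ k, b (X i k) +
      ∑ X : Fin n → Fin a → F with
        δ * n ≤ (Finset.univ.filter fun i => ∑ k, X i k = 0).card, ∏ i, ∏ k, b (X i k) := by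
        simp only [Finset.sum_filter]
        rw [Finset.sum_comm, ← Finset.sum_add_distrib]
        refine Finset.sum_le_sum fun X _ => ?_
        have hW : 0 ≤ ∏ i, ∏ k, b (X i k) := Finset.prod_nonneg fun _ _ => hw0 _
        have hS : ∀ i ∈ Finset.univ, 0 ≤ if X i ∈ V i X ∧ (Module.finrank F (V i X) : ℝ) ≤ δ * n
            then ∏ i, ∏ k, b (X i k) else 0 := fun i _ => by split_ifs <;> simp [hW]
        by_cases hE : HasDependentRow X
        · rw [if_pos hE]
          by_cases hZ : δ * n ≤ (Finset.univ.filter fun i => ∑ k, X i k = 0).card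
          · rw [if_pos hZ]
            linarith [Finset.sum_nonneg hS]
          · obtain ⟨i, hi⟩ := hE
            have hd : (Module.finrank F (V i X) : ℝ) ≤ δ * n :=
              (Nat.cast_le.2 (hVcard i X)).trans (not_le.1 hZ).le
            have := Finset.single_le_sum hS (Finset.mem_univ i)
            rw [if_pos ⟨hi, hd⟩] at this
            rw [if_neg hZ]
            linarith
        · rw [if_neg hE]
          exact add_nonneg (Finset.sum_nonneg hS) (by split_ifs <;> simp [hW])
    _ ≤ _ := by
        refine add_le_add ((Finset.sum_le_sum fun i _ => hspan i).trans ?_) hcount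
        simp

/-- A lower bound for the probability that the first `n` rows of the Laplacian are independent. -/
lemma one_sub_le_lapMeasure_rank {p : ℕ} [Fact p.Prime] {q : ℝ} (hq0 : 0 < q) (hq1 : q < 1)
    {n a : ℕ} {γ δ t : ℝ}
    (hγ : ∑ x : Fin a → ZMod p with ∑ k, x k = 0, ∏ k, (bern p q).real {x k} ≤ γ)
    (ht : 1 ≤ t) :
    1 - (n * max q (1 - q) ^ (a - δ * n) + ((1 + (t - 1) * γ) / t ^ δ) ^ n) ≤
      (lapMeasure p n a q
        {ω | (firstRows p n a n (Nat.le_add_right n a) ω).rank = n}).toReal := by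
  have hprob := bern_isProbabilityMeasure (p := p) hq0.le hq1.le
  have : IsProbabilityMeasure (lapMeasure p n a q) := by unfold lapMeasure; infer_instance
  have hbad := sum_prod_hasDependentRow_le (F := ZMod p) (n := n) (δ := δ)
    (fun _ => measureReal_nonneg) (sum_bern_real hq0.le hq1.le)
    (bern_real_singleton_le hq0.le hq1.le) (lt_max_of_lt_left hq0)
    (max_le hq1.le (by linarith)) hγ ht
  rw [← lapMeasure_edgeRows hq0.le hq1.le, ← Measure.real] at hbad
  rw [← Measure.real]
  have hsub : {ω | (firstRows p n a n (Nat.le_add_right n a) ω).rank = n}ᶜ ⊆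
      {ω | HasDependentRow (edgeRows ω)} :=
    fun ω hω => hasDependentRow_of_rank_ne hω
  have hmono := measureReal_mono (μ := lapMeasure p n a q) hsub
  rw [measureReal_compl (Set.toFinite _).measurableSet, probReal_univ] at hmono
  linarith

end Laplacian

lemma exists_chernoff_parameter {γ δ : ℝ} (hγ : 0 < γ) (hδ : γ < δ) :
    ∃ t : ℝ, 1 < t ∧ (1 + (t - 1) * γ) / t ^ δ < 1 := by
  obtain ⟨t, ht1, ht2⟩ := exists_between ((one_lt_div hγ).2 hδ)
  have ht0 : 0 < t := by linarith
  refine ⟨t, ht1, ?_⟩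
  rw [div_lt_one (Real.rpow_pos_of_pos ht0 _), Real.rpow_def_of_pos ht0]
  calc 1 + (t - 1) * γ ≤ Real.exp ((t - 1) * γ) := by
        linarith [Real.add_one_le_exp ((t - 1) * γ)]
    _ < Real.exp (Real.log t * δ) := by
        apply Real.exp_lt_exp.2
        calc (t - 1) * γ < (t - 1) * (δ / t) :=
              mul_lt_mul_of_pos_left ((lt_div_comm₀ ht0 hγ).1 ht2) (by linarith)
          _ = (1 - t⁻¹) * δ := by field_simp
          _ ≤ Real.log t * δ :=
              mul_le_mul_of_nonneg_right (Real.one_sub_inv_le_log_of_pos ht0) (by linarith)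

lemma exists_mul_pow_add_pow_le_exp {ρ s : ℝ} (hρ0 : 0 < ρ) (hρ1 : ρ < 1) (hs0 : 0 ≤ s)
    (hs1 : s < 1) :
    ∃ K > (0 : ℝ), ∃ c > (0 : ℝ), ∀ n : ℕ, n * ρ ^ n + s ^ n ≤ K * Real.exp (-c * n) := by
  have hτ0 : 0 < √ρ := Real.sqrt_pos.2 hρ0
  have hτ1 : √ρ < 1 := by rw [Real.sqrt_lt' one_pos]; simpa using hρ1
  obtain ⟨K, hK⟩ := (tendsto_self_mul_const_pow_of_lt_one hτ0.le hτ1).bddAbove_range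
  have hK' : ∀ n : ℕ, n * √ρ ^ n ≤ K := fun n => hK ⟨n, rfl⟩
  have hK0 : 0 ≤ K := by simpa using hK' 0
  set σ := max (√ρ) s
  have hσ0 : 0 < σ := lt_max_of_lt_left hτ0
  refine ⟨K + 1, by linarith, -Real.log σ, neg_pos.2 (Real.log_neg hσ0 (max_lt hτ1 hs1)),
    fun n => ?_⟩
  rw [neg_neg, ← Real.rpow_def_of_pos hσ0, Real.rpow_natCast, add_mul, one_mul]
  refine add_le_add ?_ (pow_le_pow_left₀ hs0 (le_max_right _ _) n)
  calc n * ρ ^ n = n * √ρ ^ n * √ρ ^ n := by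
        rw [mul_assoc, ← mul_pow, Real.mul_self_sqrt hρ0.le]
    _ ≤ K * σ ^ n :=
        mul_le_mul (hK' n) (pow_le_pow_left₀ hτ0.le (le_max_left _ _) n) (by positivity) hK0

/-- The first `n` rows of the Laplacian of the random directed bipartite graph have full
row rank `n` over `F_p` with probability at least `1 - C·exp(-cn)`. -/
theorem firstRows_full_rank
    (p : ℕ) (hp : p.Prime) (q : ℝ) (hq0 : 0 < q) (hq1 : q < 1)
    (α : ℚ) (hα1 : 1 / (p : ℚ) < α) (hα2 : α ≤ 1) :
    ∃ C > (0 : ℝ), ∃ c > (0 : ℝ), ∀ n : ℕ, 0 < n → ∀ a : ℕ, (a : ℚ) = α * n →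
      1 - C * Real.exp (-c * n) ≤
        ((lapMeasure p n a q)
          {ω | (firstRows p n a n (Nat.le_add_right n a) ω).rank = n}).toReal := by
  have : Fact p.Prime := ⟨hp⟩
  have hp0 : (0 : ℝ) < p := by exact_mod_cast hp.pos
  have hpα : (p : ℝ)⁻¹ < α := by
    simpa using (Rat.cast_lt (K := ℝ)).2 hα1
  have hα0 : (0 : ℝ) < α := (inv_pos.2 hp0).trans hpα
  obtain ⟨δ, hδ1, hδ2⟩ := exists_between hpα
  obtain ⟨γ, hγ1, hγ2⟩ := exists_between hδ1
  have hγ0 : 0 < γ := (inv_pos.2 hp0).trans hγ1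
  obtain ⟨t, ht1, hs1⟩ := exists_chernoff_parameter hγ0 hγ2
  obtain ⟨A, hA⟩ := eventually_atTop.1
    ((tendsto_sum_prod_bern_sum_eq_zero (p := p) hq0 hq1).eventually_le_const hγ1)
  set β := max q (1 - q)
  have hβ0 : 0 < β := lt_max_of_lt_left hq0
  have hβ1 : β < 1 := max_lt hq1 (by linarith)
  have hs0 : 0 ≤ (1 + (t - 1) * γ) / t ^ δ := by
    have : 0 ≤ t - 1 := by linarith
    positivity
  obtain ⟨K, hK0, c, hc, hK⟩ := exists_mul_pow_add_pow_le_exp (Real.rpow_pos_of_pos hβ0 (α - δ))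
    (Real.rpow_lt_one hβ0.le hβ1 (sub_pos.2 hδ2)) hs0 hs1
  refine ⟨K + Real.exp (c * (A / α)), by positivity, c, hc, fun n _ a ha => ?_⟩
  have ha' : (a : ℝ) = α * n := by exact_mod_cast congrArg (Rat.cast (K := ℝ)) ha
  rw [add_mul, ← Real.exp_add]
  rcases le_or_gt A a with hAa | hAa
  · refine le_trans ?_ (one_sub_le_lapMeasure_rank hq0 hq1 (δ := δ) (hA a hAa) ht1.le)
    have hn := hK n
    rw [← Real.rpow_natCast (β ^ ((α : ℝ) - δ)), ← Real.rpow_mul hβ0.le, sub_mul, ← ha'] at hn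
    linarith [Real.exp_pos (c * (A / α) + -c * n)]
  · have hnA : (n : ℝ) ≤ A / α := by
      rw [le_div_iff₀ hα0, mul_comm, ← ha']
      exact_mod_cast hAa.le
    have h1 : 1 ≤ Real.exp (c * (A / α) + -c * n) := by
      rw [Real.one_le_exp_iff]
      nlinarith
    have h2 : 0 ≤ K * Real.exp (-c * n) := by positivity
    exact le_trans (by linarith) ENNReal.toReal_nonneg
end

section
/- Let p be a prime, q ∈ (0,1), and let x_1, …, x_n be independent random variables in F_p, each equal to 1 with probability q and to 0 with probability 1 − q. Then |P(∑_{i=1}^n x_i = 0) − 1/p| ≤ exp(−2q(1−q)n/p²). (The paper states this bound, with constant 1/2 in place of 2q(1−q), as its Lemma on zero row sums.) -/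
open MeasureTheory

lemma integral_bern {p : ℕ} {q : ℝ} (hq0 : 0 ≤ q) (hq1 : q ≤ 1) (f : ZMod p → ℂ) :
    ∫ x, f x ∂bern p q = q * f 1 + (1 - q) * f 0 := by
  have hd (a : ZMod p) : Integrable f (Measure.dirac a) :=
    integrable_dirac (by simp)
  rw [bern, integral_add_measure ((hd 1).smul_measure ENNReal.ofReal_ne_top)
    ((hd 0).smul_measure ENNReal.ofReal_ne_top), integral_smul_measure, integral_smul_measure,
    integral_dirac, integral_dirac, ENNReal.toReal_ofReal hq0,
    ENNReal.toReal_ofReal (sub_nonneg.2 hq1)]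
  simp

lemma re_stdAddChar_le {p : ℕ} [NeZero p] {k : ZMod p} (hk : k ≠ 0) :
    (ZMod.stdAddChar k).re ≤ 1 - 8 / (p : ℝ) ^ 2 := by
  set m := k.valMinAbs with hm
  have hp : (0 : ℝ) < p := by exact_mod_cast Nat.pos_of_ne_zero (NeZero.ne p)
  have hre : (ZMod.stdAddChar k).re = Real.cos (2 * Real.pi * m / p) := by
    rw [← ZMod.coe_valMinAbs k, ZMod.stdAddChar_coe, ← Complex.exp_ofReal_mul_I_re]
    congr 2
    push_cast
    ring
  have hm0 : m ≠ 0 := fun h => hk ((ZMod.valMinAbs_eq_zero k).1 h)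
  have hm1 : (1 : ℝ) ≤ (m : ℝ) ^ 2 := by
    exact_mod_cast Int.add_one_le_of_lt (by positivity : (0 : ℤ) < m ^ 2)
  have hmp : 2 * |(m : ℝ)| ≤ p := by
    have h := ZMod.natAbs_valMinAbs_le k
    have h2 : 2 * |m| ≤ p := by
      rw [← hm] at h
      rw [Int.abs_eq_natAbs]
      omega
    exact_mod_cast h2
  have hx : |2 * Real.pi * m / p| ≤ Real.pi := by
    rw [abs_div, abs_mul, abs_of_pos Real.two_pi_pos, abs_of_pos hp, div_le_iff₀ hp]
    nlinarith [Real.pi_pos]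
  rw [hre]
  refine (Real.cos_le_one_sub_mul_cos_sq hx).trans ?_
  have : 2 / Real.pi ^ 2 * (2 * Real.pi * m / p) ^ 2 = 8 * (m : ℝ) ^ 2 / p ^ 2 := by
    field_simp
    ring
  rw [this]
  gcongr
  linarith

lemma norm_convex_comb_stdAddChar_le {p : ℕ} [NeZero p] {q : ℝ} (hq0 : 0 ≤ q) (hq1 : q ≤ 1)
    {k : ZMod p} (hk : k ≠ 0) :
    ‖(q : ℂ) * ZMod.stdAddChar k + (1 - q)‖ ≤ Real.exp (-(2 * q * (1 - q)) / p ^ 2) := by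
  have hre := re_stdAddChar_le hk
  have hnorm : ‖ZMod.stdAddChar k‖ = 1 := AddChar.norm_apply _ _
  have hsq : ‖(q : ℂ) * ZMod.stdAddChar k + (1 - q)‖ ^ 2
      = 1 - 2 * (q * (1 - q)) * (1 - (ZMod.stdAddChar k).re) := by
    have h1 : (ZMod.stdAddChar k).re ^ 2 + (ZMod.stdAddChar k).im ^ 2 = 1 := by
      have := Complex.sq_norm (ZMod.stdAddChar k)
      rw [hnorm, Complex.normSq_apply] at this
      linarith
    rw [Complex.sq_norm, Complex.normSq_apply]
    simp
    linear_combination q ^ 2 * h1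
  have hqq : 0 ≤ q * (1 - q) := mul_nonneg hq0 (sub_nonneg.2 hq1)
  refine le_of_sq_le_sq ?_ (Real.exp_pos _).le
  rw [hsq, ← Real.exp_nat_mul]
  refine le_trans ?_ (Real.add_one_le_exp _)
  have h2 : 0 ≤ q * (1 - q) / (p : ℝ) ^ 2 := by positivity
  have h3 := mul_le_mul_of_nonneg_left hre hqq
  have h4 : q * (1 - q) * (1 - 8 / (p : ℝ) ^ 2) = q * (1 - q) - 8 * (q * (1 - q) / (p : ℝ) ^ 2) := by
    ring
  have h5 : ((2 : ℕ) : ℝ) * (-(2 * q * (1 - q)) / p ^ 2) = -4 * (q * (1 - q) / (p : ℝ) ^ 2) := by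
    push_cast
    ring
  rw [h5]
  linarith

lemma sum_stdAddChar_mul {p : ℕ} [NeZero p] (a : ZMod p) :
    ∑ k : ZMod p, ZMod.stdAddChar (k * a) = if a = 0 then (p : ℂ) else 0 := by
  simpa using AddChar.sum_mulShift a (ZMod.isPrimitive_stdAddChar p)

lemma AddChar.apply_finset_sum {A M ι : Type*} [AddCommMonoid A] [CommMonoid M]
    (ψ : AddChar A M) (s : Finset ι) (f : ι → A) : ψ (∑ i ∈ s, f i) = ∏ i ∈ s, ψ (f i) :=
  map_prod ψ.toMonoidHom (fun i => Multiplicative.ofAdd (f i)) s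

lemma toReal_pi_bern_sum_eq_zero {p : ℕ} [NeZero p] {q : ℝ} (hq0 : 0 ≤ q) (hq1 : q ≤ 1) (n : ℕ) :
    ((((Measure.pi fun _ : Fin n => bern p q) {x | ∑ i, x i = 0}).toReal : ℝ) : ℂ)
      = (p : ℂ)⁻¹ * ∑ k : ZMod p, ((q : ℂ) * ZMod.stdAddChar k + (1 - q)) ^ n := by
  have hp : (p : ℂ) ≠ 0 := by exact_mod_cast NeZero.ne p
  have hchar (k : ZMod p) :
      ∫ x : Fin n → ZMod p, ZMod.stdAddChar (k * ∑ i, x i) ∂(Measure.pi fun _ => bern p q)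
        = ((q : ℂ) * ZMod.stdAddChar k + (1 - q)) ^ n := by
    simp_rw [Finset.mul_sum, AddChar.apply_finset_sum]
    rw [integral_fintype_prod_eq_prod (fun _ x => ZMod.stdAddChar (k * x))]
    simp [integral_bern hq0 hq1]
  rw [← Finset.sum_congr rfl fun k _ => hchar k, ← integral_finsetSum _ fun k _ => .of_finite]
  simp_rw [sum_stdAddChar_mul]
  have hind : (fun x : Fin n → ZMod p => if ∑ i, x i = 0 then (p : ℂ) else 0)
      = Set.indicator {x | ∑ i, x i = 0} fun _ => (p : ℂ) := by
    ext x
    simp [Set.indicator_apply]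
  rw [hind, integral_indicator_const _ (Set.toFinite _).measurableSet]
  simp [Measure.real]
  field_simp

/-- For `x_1, …, x_n` iid random variables in `F_p` taking the value `1` with probability
`q` and `0` with probability `1-q`, the probability that `∑ x_i = 0` is within
`exp(-2q(1-q)n/p²)` of `1/p`. -/
theorem sum_bernoulli_zero_mod_p
    (p : ℕ) (hp : p.Prime) (q : ℝ) (hq0 : 0 < q) (hq1 : q < 1) (n : ℕ) :
    |((Measure.pi fun _ : Fin n => bern p q) {x | ∑ i, x i = 0}).toReal - 1 / p| ≤
      Real.exp (-(2 * q * (1 - q) * n) / p ^ 2) := by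
  have : NeZero p := ⟨hp.ne_zero⟩
  have hpos : (0 : ℝ) < p := by exact_mod_cast hp.pos
  set E := Real.exp (-(2 * q * (1 - q) * n) / p ^ 2) with hE
  have hterm (k : ZMod p) (hk : k ∈ Finset.univ.erase 0) :
      ‖((q : ℂ) * ZMod.stdAddChar k + (1 - q)) ^ n‖ ≤ E := by
    rw [norm_pow]
    refine (pow_le_pow_left₀ (norm_nonneg _)
      (norm_convex_comb_stdAddChar_le hq0.le hq1.le (Finset.ne_of_mem_erase hk)) n).trans_eq ?_
    rw [hE, ← Real.exp_nat_mul]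
    congr 1
    ring
  have hsum := norm_sum_le_of_le _ hterm
  rw [Finset.sum_const, Finset.card_erase_of_mem (Finset.mem_univ _), Finset.card_univ,
    ZMod.card, nsmul_eq_mul] at hsum
  rw [← Real.norm_eq_abs, ← Complex.norm_real]
  push_cast
  rw [toReal_pi_bern_sum_eq_zero hq0.le hq1.le,
    ← Finset.add_sum_erase _ _ (Finset.mem_univ (0 : ZMod p))]
  simp only [AddChar.map_zero_eq_one, mul_one, add_sub_cancel, one_pow, mul_add, one_div,
    add_sub_cancel_left, norm_mul, norm_inv, Complex.norm_natCast]
  rw [inv_mul_le_iff₀ hpos]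
  refine hsum.trans (mul_le_mul_of_nonneg_right ?_ (Real.exp_pos _).le)
  exact_mod_cast Nat.sub_le p 1
end
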